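/- Let M be a feasible matching in a marriage instance with critical men, and suppose some level assignment satisfies the dominant conditions for M. Then M is a dominant feasible matching. -/

import Mathlib

open Classical

universe u v

/-- A marriage instance with critical men: a finite bipartite graph with edge set `E ⊆ A × B`,
a set `C ⊆ A` of critical men, and strict preference orders of each vertex over its
neighbours (`prefA m w w'` : man `m` strictly prefers woman `w` to woman `w'`;
`prefB w m m'` : woman `w` strictly prefers man `m` to man `m'`). -/
structure CritInstance (A : Type u) (B : Type v) where
  E : Finset (A × B)
  C : Finset A
  prefA : A → B → B → Prop
  prefB : B → A → A → Prop
  prefA_irrefl : ∀ m w, ¬ prefA m w w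
  prefA_trans : ∀ m w₁ w₂ w₃, prefA m w₁ w₂ → prefA m w₂ w₃ → prefA m w₁ w₃
  prefA_total : ∀ m w₁ w₂, (m, w₁) ∈ E → (m, w₂) ∈ E → w₁ ≠ w₂ →
    prefA m w₁ w₂ ∨ prefA m w₂ w₁
  prefB_irrefl : ∀ w m, ¬ prefB w m m
  prefB_trans : ∀ w m₁ m₂ m₃, prefB w m₁ m₂ → prefB w m₂ m₃ → prefB w m₁ m₃
  prefB_total : ∀ w m₁ m₂, (m₁, w) ∈ E → (m₂, w) ∈ E → m₁ ≠ m₂ →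
    prefB w m₁ m₂ ∨ prefB w m₂ m₁

namespace CritInstance

variable {A : Type u} {B : Type v}

/-- `M` is a matching: a set of edges in which every vertex has at most one partner. -/
def IsMatching (I : CritInstance A B) (M : Finset (A × B)) : Prop :=
  M ⊆ I.E ∧ (∀ ⦃m w w'⦄, (m, w) ∈ M → (m, w') ∈ M → w = w') ∧
    (∀ ⦃m m' w⦄, (m, w) ∈ M → (m', w) ∈ M → m = m')

/-- Man `m` is matched in `M`. -/
def ManMatched (M : Finset (A × B)) (m : A) : Prop := ∃ w, (m, w) ∈ M

/-- Woman `w` is matched in `M`. -/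
def WomanMatched (M : Finset (A × B)) (w : B) : Prop := ∃ m, (m, w) ∈ M

/-- `M` is feasible: it is a matching and every critical man is matched. -/
def IsFeasible (I : CritInstance A B) (M : Finset (A × B)) : Prop :=
  IsMatching I M ∧ ∀ m ∈ I.C, ManMatched M m

/-- Man `m` prefers matching `M` to matching `N`: he is matched in `M` and either
unmatched in `N` or strictly prefers his `M`-partner to his `N`-partner. -/
def ManPrefers (I : CritInstance A B) (M N : Finset (A × B)) (m : A) : Prop :=
  ∃ w, (m, w) ∈ M ∧ (¬ ManMatched N m ∨ ∃ w', (m, w') ∈ N ∧ I.prefA m w w')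

/-- Woman `w` prefers matching `M` to matching `N`. -/
def WomanPrefers (I : CritInstance A B) (M N : Finset (A × B)) (w : B) : Prop :=
  ∃ m, (m, w) ∈ M ∧ (¬ WomanMatched N w ∨ ∃ m', (m', w) ∈ N ∧ I.prefB w m m')

/-- `phi I M N` is the number of vertices that prefer `M` to `N`. -/
noncomputable def phi [Fintype A] [Fintype B] (I : CritInstance A B)
    (M N : Finset (A × B)) : ℕ :=
  (Finset.univ.filter fun m : A => ManPrefers I M N m).card +
    (Finset.univ.filter fun w : B => WomanPrefers I M N w).card

/-- `M` is a popular feasible matching. -/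
def IsPFM [Fintype A] [Fintype B] (I : CritInstance A B) (M : Finset (A × B)) : Prop :=
  IsFeasible I M ∧ ∀ N, IsFeasible I N → phi I N M ≤ phi I M N

/-- `M` is a minimum size popular feasible matching. -/
def IsMinPFM [Fintype A] [Fintype B] (I : CritInstance A B) (M : Finset (A × B)) : Prop :=
  IsPFM I M ∧ ∀ N, IsPFM I N → M.card ≤ N.card

/-- `M` is a dominant feasible matching. -/
def IsDFM [Fintype A] [Fintype B] (I : CritInstance A B) (M : Finset (A × B)) : Prop :=
  IsPFM I M ∧ ∀ N, IsFeasible I N → M.card < N.card → phi I N M < phi I M N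

/-- `(m,w)` is a `(+1,+1)` edge with respect to `M`: an edge of `E ∖ M` such that `m` is
unmatched or prefers `w` to his partner, and `w` is unmatched or prefers `m` to her partner. -/
def PlusPlus (I : CritInstance A B) (M : Finset (A × B)) (m : A) (w : B) : Prop :=
  (m, w) ∈ I.E ∧ (m, w) ∉ M ∧
    (¬ ManMatched M m ∨ ∃ w', (m, w') ∈ M ∧ I.prefA m w w') ∧
    (¬ WomanMatched M w ∨ ∃ m', (m', w) ∈ M ∧ I.prefB w m m')

/-- `(m,w)` is a `(−1,−1)` edge with respect to `M`: an edge of `E ∖ M` such that `m` is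
matched and prefers his partner to `w`, and `w` is matched and prefers her partner to `m`. -/
def MinusMinus (I : CritInstance A B) (M : Finset (A × B)) (m : A) (w : B) : Prop :=
  (m, w) ∈ I.E ∧ (m, w) ∉ M ∧
    (∃ w', (m, w') ∈ M ∧ I.prefA m w' w) ∧
    (∃ m', (m', w) ∈ M ∧ I.prefB w m' m)

/-- `M` is a stable matching: a matching with no blocking pair. -/
def IsStable (I : CritInstance A B) (M : Finset (A × B)) : Prop :=
  IsMatching I M ∧ ∀ m w, ¬ PlusPlus I M m w

/-- The min-size conditions for a level assignment `(lA, lB)` with respect to `M`: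
(i) matched partners share a level, unmatched vertices have level 0, non-critical men
have level 0; (ii) every `(+1,+1)` edge goes from a man to a strictly higher level woman;
(iii) every edge from a man at level `i` to a woman at level `i − 1` is a `(−1,−1)` edge;
(iv) no edge goes from a man at level `i` to a woman at level `≤ i − 2`. -/
def MinSizeConds (I : CritInstance A B) (M : Finset (A × B))
    (lA : A → ℕ) (lB : B → ℕ) : Prop :=
  (∀ m w, (m, w) ∈ M → lA m = lB w) ∧
  (∀ m, ¬ ManMatched M m → lA m = 0) ∧
  (∀ w, ¬ WomanMatched M w → lB w = 0) ∧
  (∀ m, m ∉ I.C → lA m = 0) ∧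
  (∀ m w, PlusPlus I M m w → lA m < lB w) ∧
  (∀ m w, (m, w) ∈ I.E → lB w + 1 = lA m → MinusMinus I M m w) ∧
  (∀ m w, (m, w) ∈ I.E → ¬ (lB w + 2 ≤ lA m))

/-- The dominant conditions for a level assignment `(lA, lB)` with respect to `M`:
(i) matched partners share a level, unmatched women have level 0, unmatched men have
level 1, non-critical men have level at most 1; (ii)–(iv) as in the min-size conditions. -/
def DomConds (I : CritInstance A B) (M : Finset (A × B))
    (lA : A → ℕ) (lB : B → ℕ) : Prop :=
  (∀ m w, (m, w) ∈ M → lA m = lB w) ∧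
  (∀ m, ¬ ManMatched M m → lA m = 1) ∧
  (∀ w, ¬ WomanMatched M w → lB w = 0) ∧
  (∀ m, m ∉ I.C → lA m ≤ 1) ∧
  (∀ m w, PlusPlus I M m w → lA m < lB w) ∧
  (∀ m w, (m, w) ∈ I.E → lB w + 1 = lA m → MinusMinus I M m w) ∧
  (∀ m w, (m, w) ∈ I.E → ¬ (lB w + 2 ≤ lA m))

/-- Adjacency in the bipartite graph, on the vertex set `A ⊕ B`. -/
def Adj (I : CritInstance A B) : A ⊕ B → A ⊕ B → Prop
  | Sum.inl m, Sum.inr w => (m, w) ∈ I.E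
  | Sum.inr w, Sum.inl m => (m, w) ∈ I.E
  | _, _ => False

/-- The (directed) pair `(u, v)` of vertices spans an edge of the matching `M`. -/
def StepM (M : Finset (A × B)) : A ⊕ B → A ⊕ B → Prop
  | Sum.inl m, Sum.inr w => (m, w) ∈ M
  | Sum.inr w, Sum.inl m => (m, w) ∈ M
  | _, _ => False

/-- The pair `(u, v)` of vertices spans a `(+1,+1)` edge with respect to `M`. -/
def StepPP (I : CritInstance A B) (M : Finset (A × B)) : A ⊕ B → A ⊕ B → Prop
  | Sum.inl m, Sum.inr w => PlusPlus I M m w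
  | Sum.inr w, Sum.inl m => PlusPlus I M m w
  | _, _ => False

/-- The pair `(u, v)` of vertices spans a `(−1,−1)` edge with respect to `M`. -/
def StepMM (I : CritInstance A B) (M : Finset (A × B)) : A ⊕ B → A ⊕ B → Prop
  | Sum.inl m, Sum.inr w => MinusMinus I M m w
  | Sum.inr w, Sum.inl m => MinusMinus I M m w
  | _, _ => False

/-- A vertex of `A ⊕ B` is matched in `M`. -/
def VMatched (M : Finset (A × B)) : A ⊕ B → Prop
  | Sum.inl m => ManMatched M m
  | Sum.inr w => WomanMatched M w

/-- An `M`-alternating path in the graph: a sequence of distinct vertices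
`vert 0, …, vert len` (`len ≥ 1` edges), consecutive vertices adjacent, with
consecutive edges alternately inside and outside `M`. -/
structure AltPath (I : CritInstance A B) (M : Finset (A × B)) where
  len : ℕ
  len_pos : 0 < len
  vert : ℕ → A ⊕ B
  inj : ∀ i j, i ≤ len → j ≤ len → vert i = vert j → i = j
  adj : ∀ i, i < len → Adj I (vert i) (vert (i + 1))
  alternate : ∀ i, i + 1 < len →
    (StepM M (vert i) (vert (i + 1)) ↔ ¬ StepM M (vert (i + 1)) (vert (i + 2)))

namespace AltPath

variable {I : CritInstance A B} {M : Finset (A × B)}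

/-- The number of `(+1,+1)` edges of the path. -/
noncomputable def countPP (ρ : AltPath I M) : ℕ :=
  ((Finset.range ρ.len).filter fun i => StepPP I M (ρ.vert i) (ρ.vert (i + 1))).card

/-- The number of `(−1,−1)` edges of the path. -/
noncomputable def countMM (ρ : AltPath I M) : ℕ :=
  ((Finset.range ρ.len).filter fun i => StepMM I M (ρ.vert i) (ρ.vert (i + 1))).card

/-- The vertex `u` lies on the path. -/
def Mem (ρ : AltPath I M) (u : A ⊕ B) : Prop := ∃ i ≤ ρ.len, ρ.vert i = u

/-- The set of edges of the path, as a set of pairs in `A × B`. -/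
noncomputable def edges (ρ : AltPath I M) : Finset (A × B) :=
  I.E.filter fun e => ∃ i < ρ.len,
    (ρ.vert i = Sum.inl e.1 ∧ ρ.vert (i + 1) = Sum.inr e.2) ∨
    (ρ.vert i = Sum.inr e.2 ∧ ρ.vert (i + 1) = Sum.inl e.1)

end AltPath

/-- An `M`-alternating cycle: a closed sequence of vertices `vert 0, …, vert len = vert 0`
(distinct except for the return), consecutive vertices adjacent, with edges alternately
inside and outside `M`, including around the wrap. -/
structure AltCycle (I : CritInstance A B) (M : Finset (A × B)) where
  len : ℕ
  len_pos : 0 < len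
  vert : ℕ → A ⊕ B
  closed : vert len = vert 0
  inj : ∀ i j, i < len → j < len → vert i = vert j → i = j
  adj : ∀ i, i < len → Adj I (vert i) (vert (i + 1))
  alternate : ∀ i, i + 1 < len →
    (StepM M (vert i) (vert (i + 1)) ↔ ¬ StepM M (vert (i + 1)) (vert (i + 2)))
  alternate_wrap : StepM M (vert (len - 1)) (vert len) ↔ ¬ StepM M (vert 0) (vert 1)

namespace AltCycle

variable {I : CritInstance A B} {M : Finset (A × B)}

/-- The number of `(+1,+1)` edges of the cycle. -/
noncomputable def countPP (σ : AltCycle I M) : ℕ :=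
  ((Finset.range σ.len).filter fun i => StepPP I M (σ.vert i) (σ.vert (i + 1))).card

/-- The number of `(−1,−1)` edges of the cycle. -/
noncomputable def countMM (σ : AltCycle I M) : ℕ :=
  ((Finset.range σ.len).filter fun i => StepMM I M (σ.vert i) (σ.vert (i + 1))).card

end AltCycle

/-- A size-increasing alternating path (SIAP) for `M`: an `M`-alternating path whose two
endpoints are a man unmatched in `M` and a woman unmatched in `M`, and which has equally
many `(+1,+1)` and `(−1,−1)` edges. -/
def IsSIAP (I : CritInstance A B) (M : Finset (A × B)) (ρ : AltPath I M) : Prop :=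
  (((∃ m, ρ.vert 0 = Sum.inl m ∧ ¬ ManMatched M m) ∧
      (∃ w, ρ.vert ρ.len = Sum.inr w ∧ ¬ WomanMatched M w)) ∨
    ((∃ w, ρ.vert 0 = Sum.inr w ∧ ¬ WomanMatched M w) ∧
      (∃ m, ρ.vert ρ.len = Sum.inl m ∧ ¬ ManMatched M m))) ∧
  ρ.countPP = ρ.countMM

/-- A size-reducing alternating path (SRAP) for `M` with respect to the level assignment
`(lA, lB)`: an `M`-alternating path both of whose terminal edges lie in `M`, starting at a
woman matched in `M` at level 0, ending at a non-critical man at level 1, whose number of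
`(+1,+1)` edges is exactly one more than its number of `(−1,−1)` edges. -/
def IsSRAP (I : CritInstance A B) (M : Finset (A × B)) (lA : A → ℕ) (lB : B → ℕ)
    (ρ : AltPath I M) : Prop :=
  StepM M (ρ.vert 0) (ρ.vert 1) ∧
  StepM M (ρ.vert (ρ.len - 1)) (ρ.vert ρ.len) ∧
  (((∃ w, ρ.vert 0 = Sum.inr w ∧ WomanMatched M w ∧ lB w = 0) ∧
      (∃ m, ρ.vert ρ.len = Sum.inl m ∧ m ∉ I.C ∧ lA m = 1)) ∨
    ((∃ m, ρ.vert 0 = Sum.inl m ∧ m ∉ I.C ∧ lA m = 1) ∧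
      (∃ w, ρ.vert ρ.len = Sum.inr w ∧ WomanMatched M w ∧ lB w = 0))) ∧
  ρ.countPP = ρ.countMM + 1

end CritInstance

namespace CritInstance

variable {A : Type u} {B : Type v}

/-- The net vote of man `m` for `N` against `M`. -/
noncomputable def manVote (I : CritInstance A B) (N M : Finset (A × B)) (m : A) : ℤ :=
  (if ManPrefers I N M m then 1 else 0) - (if ManPrefers I M N m then 1 else 0)

/-- The net vote of woman `w` for `N` against `M`. -/
noncomputable def womanVote (I : CritInstance A B) (N M : Finset (A × B)) (w : B) : ℤ :=
  (if WomanPrefers I N M w then 1 else 0) - (if WomanPrefers I M N w then 1 else 0)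

lemma phi_sub_phi [Fintype A] [Fintype B] (I : CritInstance A B) (N M : Finset (A × B)) :
    (phi I N M : ℤ) - phi I M N = ∑ m, manVote I N M m + ∑ w, womanVote I N M w := by
  simp only [phi, manVote, womanVote, Finset.sum_sub_distrib, Finset.card_filter]
  push_cast
  ring

lemma IsMatching.sum_men [Fintype A] {I : CritInstance A B} {N : Finset (A × B)}
    (hN : I.IsMatching N) (f : A → ℤ) :
    ∑ m, f m = ∑ e ∈ N, f e.1 + ∑ m with ¬ ManMatched N m, f m := by
  have himage : Finset.univ.filter (fun m => ManMatched N m) = N.image Prod.fst := by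
    ext m
    rw [Finset.mem_filter]
    simp [ManMatched]
  rw [← Finset.sum_filter_add_sum_filter_not Finset.univ (fun m => ManMatched N m), himage,
    Finset.sum_image]
  rintro ⟨m, w⟩ h ⟨m', w'⟩ h' rfl
  exact Prod.ext rfl (hN.2.1 h h')

lemma IsMatching.sum_women [Fintype B] {I : CritInstance A B} {N : Finset (A × B)}
    (hN : I.IsMatching N) (f : B → ℤ) :
    ∑ w, f w = ∑ e ∈ N, f e.2 + ∑ w with ¬ WomanMatched N w, f w := by
  have himage : Finset.univ.filter (fun w => WomanMatched N w) = N.image Prod.snd := by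
    ext w
    rw [Finset.mem_filter]
    simp [WomanMatched]
  rw [← Finset.sum_filter_add_sum_filter_not Finset.univ (fun w => WomanMatched N w), himage,
    Finset.sum_image]
  rintro ⟨m, w⟩ h ⟨m', w'⟩ h' rfl
  exact Prod.ext (hN.2.2 h h') rfl

lemma IsMatching.card_unmatched_men [Fintype A] {I : CritInstance A B} {N : Finset (A × B)}
    (hN : I.IsMatching N) :
    ((Finset.univ.filter fun m => ¬ ManMatched N m).card : ℤ) = Fintype.card A - N.card := by
  have := hN.sum_men fun _ => 1
  simp only [Finset.sum_const, nsmul_eq_mul, mul_one, Finset.card_univ] at this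
  linarith

lemma IsMatching.card_unmatched_women [Fintype B] {I : CritInstance A B} {N : Finset (A × B)}
    (hN : I.IsMatching N) :
    ((Finset.univ.filter fun w => ¬ WomanMatched N w).card : ℤ) = Fintype.card B - N.card := by
  have := hN.sum_women fun _ => 1
  simp only [Finset.sum_const, nsmul_eq_mul, mul_one, Finset.card_univ] at this
  linarith

lemma manVote_le_one (I : CritInstance A B) (N M : Finset (A × B)) (m : A) :
    manVote I N M m ≤ 1 := by
  unfold manVote
  split_ifs <;> norm_num

lemma womanVote_le_one (I : CritInstance A B) (N M : Finset (A × B)) (w : B) :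
    womanVote I N M w ≤ 1 := by
  unfold womanVote
  split_ifs <;> norm_num

lemma manVote_of_unmatched (I : CritInstance A B) {N M : Finset (A × B)} {m : A}
    (h : ¬ ManMatched N m) :
    manVote I N M m = if ManMatched M m then -1 else 0 := by
  have hN : ¬ ManPrefers I N M m := fun ⟨w, hw, _⟩ => h ⟨w, hw⟩
  have hM : ManPrefers I M N m ↔ ManMatched M m :=
    ⟨fun ⟨w, hw, _⟩ => ⟨w, hw⟩, fun ⟨w, hw⟩ => ⟨w, hw, Or.inl h⟩⟩
  simp only [manVote, if_neg hN, hM]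
  split_ifs <;> simp

lemma womanVote_of_unmatched (I : CritInstance A B) {N M : Finset (A × B)} {w : B}
    (h : ¬ WomanMatched N w) :
    womanVote I N M w = if WomanMatched M w then -1 else 0 := by
  have hN : ¬ WomanPrefers I N M w := fun ⟨m, hm, _⟩ => h ⟨m, hm⟩
  have hM : WomanPrefers I M N w ↔ WomanMatched M w :=
    ⟨fun ⟨m, hm, _⟩ => ⟨m, hm⟩, fun ⟨m, hm⟩ => ⟨m, hm, Or.inl h⟩⟩
  simp only [womanVote, if_neg hN, hM]
  split_ifs <;> simp

lemma manVote_of_mem_inter {I : CritInstance A B} {N M : Finset (A × B)}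
    (hN : I.IsMatching N) (hM : I.IsMatching M) {m : A} {w : B}
    (h : (m, w) ∈ N) (h' : (m, w) ∈ M) : manVote I N M m = 0 := by
  have key : ∀ {P Q : Finset (A × B)}, I.IsMatching P → I.IsMatching Q → (m, w) ∈ P →
      (m, w) ∈ Q → ¬ ManPrefers I P Q m := by
    rintro P Q hP hQ hp hq ⟨v, hv, hu | ⟨v', hv', hpref⟩⟩
    · exact hu ⟨w, hq⟩
    · obtain rfl := hP.2.1 hp hv
      obtain rfl := hQ.2.1 hq hv'
      exact I.prefA_irrefl _ _ hpref
  simp [manVote, key hN hM h h', key hM hN h' h]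

lemma womanVote_of_mem_inter {I : CritInstance A B} {N M : Finset (A × B)}
    (hN : I.IsMatching N) (hM : I.IsMatching M) {m : A} {w : B}
    (h : (m, w) ∈ N) (h' : (m, w) ∈ M) : womanVote I N M w = 0 := by
  have key : ∀ {P Q : Finset (A × B)}, I.IsMatching P → I.IsMatching Q → (m, w) ∈ P →
      (m, w) ∈ Q → ¬ WomanPrefers I P Q w := by
    rintro P Q hP hQ hp hq ⟨v, hv, hu | ⟨v', hv', hpref⟩⟩
    · exact hu ⟨m, hq⟩
    · obtain rfl := hP.2.2 hp hv
      obtain rfl := hQ.2.2 hq hv'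
      exact I.prefB_irrefl _ _ hpref
  simp [womanVote, key hN hM h h', key hM hN h' h]

lemma manVote_eq_neg_one {I : CritInstance A B} {N M : Finset (A × B)}
    (hN : I.IsMatching N) (hM : I.IsMatching M) {m : A} {w w' : B}
    (h : (m, w) ∈ N) (h' : (m, w') ∈ M) (hpref : I.prefA m w' w) :
    manVote I N M m = -1 := by
  have h1 : ManPrefers I M N m := ⟨w', h', Or.inr ⟨w, h, hpref⟩⟩
  have h2 : ¬ ManPrefers I N M m := by
    rintro ⟨v, hv, hu | ⟨v', hv', hp⟩⟩
    · exact hu ⟨w', h'⟩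
    · obtain rfl := hN.2.1 h hv
      obtain rfl := hM.2.1 h' hv'
      exact I.prefA_irrefl _ _ (I.prefA_trans _ _ _ _ hp hpref)
  simp [manVote, h1, h2]

lemma womanVote_eq_neg_one {I : CritInstance A B} {N M : Finset (A × B)}
    (hN : I.IsMatching N) (hM : I.IsMatching M) {m m' : A} {w : B}
    (h : (m, w) ∈ N) (h' : (m', w) ∈ M) (hpref : I.prefB w m' m) :
    womanVote I N M w = -1 := by
  have h1 : WomanPrefers I M N w := ⟨m', h', Or.inr ⟨m, h, hpref⟩⟩
  have h2 : ¬ WomanPrefers I N M w := by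
    rintro ⟨v, hv, hu | ⟨v', hv', hp⟩⟩
    · exact hu ⟨m', h'⟩
    · obtain rfl := hN.2.2 h hv
      obtain rfl := hM.2.2 h' hv'
      exact I.prefB_irrefl _ _ (I.prefB_trans _ _ _ _ hp hpref)
  simp [womanVote, h1, h2]

lemma manVote_eq_neg_one_of_not {I : CritInstance A B} {N M : Finset (A × B)}
    (hN : I.IsMatching N) (hM : I.IsMatching M) {m : A} {w : B} (h : (m, w) ∈ N)
    (h' : (m, w) ∉ M) (hnot : ¬ (¬ ManMatched M m ∨ ∃ w', (m, w') ∈ M ∧ I.prefA m w w')) :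
    manVote I N M m = -1 := by
  push Not at hnot
  obtain ⟨⟨w', hw'⟩, hall⟩ := hnot
  have hne : w ≠ w' := fun e => h' (e ▸ hw')
  exact manVote_eq_neg_one hN hM h hw'
    ((I.prefA_total m w w' (hN.1 h) (hM.1 hw') hne).resolve_left (hall w' hw'))

lemma womanVote_eq_neg_one_of_not {I : CritInstance A B} {N M : Finset (A × B)}
    (hN : I.IsMatching N) (hM : I.IsMatching M) {m : A} {w : B} (h : (m, w) ∈ N)
    (h' : (m, w) ∉ M)
    (hnot : ¬ (¬ WomanMatched M w ∨ ∃ m', (m', w) ∈ M ∧ I.prefB w m m')) :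
    womanVote I N M w = -1 := by
  push Not at hnot
  obtain ⟨⟨m', hm'⟩, hall⟩ := hnot
  have hne : m ≠ m' := fun e => h' (e ▸ hm')
  exact womanVote_eq_neg_one hN hM h hm'
    ((I.prefB_total w m m' (hN.1 h) (hM.1 hm') hne).resolve_left (hall m' hm'))

/-- The net vote of the two ends of an edge of `N` is at most twice the increase of the level
along that edge. -/
lemma DomConds.edge_vote_le {I : CritInstance A B} {N M : Finset (A × B)} {lA : A → ℕ}
    {lB : B → ℕ} (h : I.DomConds M lA lB) (hN : I.IsMatching N) (hM : I.IsMatching M)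
    {m : A} {w : B} (hmw : (m, w) ∈ N) :
    manVote I N M m + womanVote I N M w ≤ 2 * (lB w : ℤ) - 2 * (lA m : ℤ) := by
  obtain ⟨hlevel, -, -, -, hPP, hMM, hsteep⟩ := h
  have hm := manVote_le_one I N M m
  have hw := womanVote_le_one I N M w
  by_cases hmem : (m, w) ∈ M
  · rw [manVote_of_mem_inter hN hM hmw hmem, womanVote_of_mem_inter hN hM hmw hmem,
      hlevel m w hmem]
    simp
  have hE := hN.1 hmw
  have hge := hsteep m w hE
  rcases lt_trichotomy (lA m) (lB w) with hlt | heq | hgt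
  · omega
  · have hnot : ¬ PlusPlus I M m w := fun hp => by
      have := hPP m w hp
      omega
    by_cases hman : ¬ ManMatched M m ∨ ∃ w', (m, w') ∈ M ∧ I.prefA m w w'
    · have := womanVote_eq_neg_one_of_not hN hM hmw hmem
        fun hwoman => hnot ⟨hE, hmem, hman, hwoman⟩
      omega
    · have := manVote_eq_neg_one_of_not hN hM hmw hmem hman
      omega
  · obtain ⟨-, -, ⟨w', hw', hpw⟩, ⟨m', hm', hpm⟩⟩ := hMM m w hE (by omega)
    have := manVote_eq_neg_one hN hM hmw hw' hpw
    have := womanVote_eq_neg_one hN hM hmw hm' hpm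
    omega

/-- The total level of the men exceeds that of the women by the number of unmatched men. -/
lemma DomConds.sum_levels [Fintype A] [Fintype B] {I : CritInstance A B} {M : Finset (A × B)}
    {lA : A → ℕ} {lB : B → ℕ} (h : I.DomConds M lA lB) (hM : I.IsMatching M) :
    ∑ m, (lA m : ℤ) = ∑ w, (lB w : ℤ) + (Fintype.card A - M.card) := by
  obtain ⟨hlevel, hman, hwoman, -⟩ := h
  have hmatched : ∑ e ∈ M, (lA e.1 : ℤ) = ∑ e ∈ M, (lB e.2 : ℤ) :=
    Finset.sum_congr rfl fun e he => by rw [hlevel e.1 e.2 he]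
  have hmen : ∑ m with ¬ ManMatched M m, (lA m : ℤ) = Fintype.card A - M.card := by
    rw [← hM.card_unmatched_men, Finset.cast_card]
    exact Finset.sum_congr rfl fun m hm => by simp [hman m (Finset.mem_filter.1 hm).2]
  have hwomen : ∑ w with ¬ WomanMatched M w, (lB w : ℤ) = 0 :=
    Finset.sum_eq_zero fun w hw => by simp [hwoman w (Finset.mem_filter.1 hw).2]
  rw [hM.sum_men, hM.sum_women, hmatched, hmen, hwomen]
  ring

lemma DomConds.sum_unmatched_men_le [Fintype A] {I : CritInstance A B}
    {N M : Finset (A × B)} {lA : A → ℕ} {lB : B → ℕ} (h : I.DomConds M lA lB)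
    (hN : I.IsFeasible N) (hM : I.IsMatching M) :
    ∑ m with ¬ ManMatched N m, (manVote I N M m + 2 * (lA m : ℤ)) ≤
      (Fintype.card A - N.card) + min (Fintype.card A - N.card : ℤ) (Fintype.card A - M.card) := by
  obtain ⟨-, -, -, hcrit, -⟩ := h
  have hle : ∑ m with ¬ ManMatched N m, (manVote I N M m + 2 * (lA m : ℤ)) ≤
      ∑ m with ¬ ManMatched N m, (1 + if ¬ ManMatched M m then (1 : ℤ) else 0) := by
    refine Finset.sum_le_sum fun m hm => ?_
    have hm := (Finset.mem_filter.1 hm).2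
    have := hcrit m fun hC => hm (hN.2 m hC)
    rw [manVote_of_unmatched I hm]
    by_cases hMm : ManMatched M m <;> simp [hMm] <;> omega
  refine hle.trans ?_
  rw [Finset.sum_add_distrib, ← Finset.cast_card, hN.1.card_unmatched_men,
    ← hM.card_unmatched_men, ← hN.1.card_unmatched_men, ← Finset.sum_filter, ← Finset.cast_card]
  refine add_le_add_right (le_min ?_ ?_) _ <;> refine Nat.cast_le.2 (Finset.card_le_card ?_)
  · exact Finset.filter_subset _ _
  · exact Finset.filter_subset_filter _ (Finset.subset_univ _)

lemma sum_unmatched_women_le [Fintype B] {I : CritInstance A B} {N M : Finset (A × B)}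
    (lB : B → ℕ) (hN : I.IsMatching N) (hM : I.IsMatching M) :
    ∑ w with ¬ WomanMatched N w, (womanVote I N M w - 2 * (lB w : ℤ)) ≤
      (N.card : ℤ) - M.card := by
  have hle : ∑ w with ¬ WomanMatched N w, (womanVote I N M w - 2 * (lB w : ℤ)) ≤
      ∑ w with ¬ WomanMatched N w, ((if ¬ WomanMatched M w then (1 : ℤ) else 0) - 1) := by
    refine Finset.sum_le_sum fun w hw => ?_
    rw [womanVote_of_unmatched I (Finset.mem_filter.1 hw).2]
    by_cases hMw : WomanMatched M w <;> simp [hMw]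
  have hcard : ((Finset.univ.filter fun w => ¬ WomanMatched N w).filter
      fun w => ¬ WomanMatched M w).card ≤ (Finset.univ.filter fun w => ¬ WomanMatched M w).card :=
    Finset.card_le_card (Finset.filter_subset_filter _ (Finset.subset_univ _))
  refine hle.trans ?_
  rw [Finset.sum_sub_distrib, ← Finset.sum_filter, ← Finset.cast_card, ← Finset.cast_card,
    hN.card_unmatched_women]
  have := hM.card_unmatched_women
  omega

lemma DomConds.phi_sub_phi_le [Fintype A] [Fintype B] {I : CritInstance A B}
    {N M : Finset (A × B)} {lA : A → ℕ} {lB : B → ℕ} (h : I.DomConds M lA lB)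
    (hN : I.IsFeasible N) (hM : I.IsMatching M) :
    (phi I N M : ℤ) - phi I M N ≤ min 0 ((M.card : ℤ) - N.card) := by
  have hmen := hN.1.sum_men fun m => manVote I N M m + 2 * (lA m : ℤ)
  have hwomen := hN.1.sum_women fun w => womanVote I N M w - 2 * (lB w : ℤ)
  have hedges : ∑ e ∈ N, (manVote I N M e.1 + 2 * (lA e.1 : ℤ)) +
      ∑ e ∈ N, (womanVote I N M e.2 - 2 * (lB e.2 : ℤ)) ≤ 0 := by
    rw [← Finset.sum_add_distrib]
    refine Finset.sum_nonpos fun e he => ?_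
    have := h.edge_vote_le hN.1 hM (m := e.1) (w := e.2) he
    linarith
  have hlevels := h.sum_levels hM
  have hunmen := h.sum_unmatched_men_le hN hM
  have hunwomen := sum_unmatched_women_le lB hN.1 hM
  rw [Finset.sum_add_distrib, ← Finset.mul_sum] at hmen
  rw [Finset.sum_sub_distrib, ← Finset.mul_sum] at hwomen
  rw [phi_sub_phi]
  omega

end CritInstance

/-- If `M` is a feasible matching and some level assignment satisfies the
dominant conditions for `M`, then `M` is a dominant feasible matching. -/
theorem domConds_isDFM {A : Type u} {B : Type v} [Fintype A] [Fintype B]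
    (I : CritInstance A B) (M : Finset (A × B)) (hM : I.IsFeasible M)
    (lA : A → ℕ) (lB : B → ℕ) (h : I.DomConds M lA lB) :
    I.IsDFM M := by
  refine ⟨⟨hM, fun N hN => ?_⟩, fun N hN hcard => ?_⟩ <;>
    · have := h.phi_sub_phi_le hN hM.1
      omega
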